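/- (Equation (2.4): gradient of consumer welfare equals market share) If F is tie-null at x ∈ ℝ^J, then U is (Fréchet) differentiable at x and its gradient at x equals the market-share vector σ(x); in particular ∂U(x)/∂x_j = σ_j(x) = F({ε : x_j + ε_j ≥ max(0, max_{q} (x_q + ε_q))}) for every j = 1,…,J. -/

import Mathlib

open MeasureTheory
open Filter Topology

section

variable {ι Ω E : Type*} [Fintype ι] [MeasurableSpace Ω] {μ : Measure Ω} [NormedAddCommGroup E]
  [NormedSpace ℝ E] {c : ι → Ω → ℝ}

lemma integrable_sum_smul_const (hc : ∀ i, Integrable (c i) μ) (v : ι → E) :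
    Integrable (fun ω => ∑ i, c i ω • v i) μ :=
  integrable_finsetSum _ fun i _ => (hc i).smul_const (v i)

lemma integral_sum_smul_const [CompleteSpace E] (hc : ∀ i, Integrable (c i) μ) (v : ι → E) :
    ∫ ω, ∑ i, c i ω • v i ∂μ = ∑ i, (∫ ω, c i ω ∂μ) • v i := by
  rw [integral_finsetSum _ fun i _ => (hc i).smul_const (v i)]
  simp only [integral_smul_const]

end

/-- The welfare `max 0 (max_j y_j)` of a consumer with utilities `y` and an outside option of
utility `0`. -/
noncomputable def maxUtility {ι : Type*} (y : EuclideanSpace ℝ ι) : ℝ := max 0 (⨆ j, y j)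

/-- The set of utility vectors at which the option `j` is optimal. -/
def optimalRegion {ι : Type*} (j : ι) : Set (EuclideanSpace ℝ ι) := {y | maxUtility y ≤ y j}

/-- The formal derivative of `maxUtility`: the sum of the coordinates of the optimal options. -/
noncomputable def maxUtilityDeriv {ι : Type*} [Fintype ι] (y : EuclideanSpace ℝ ι) :
    EuclideanSpace ℝ ι →L[ℝ] ℝ :=
  ∑ j, (optimalRegion j).indicator (fun _ => (1 : ℝ)) y • EuclideanSpace.proj j

section

variable {ι : Type*}

lemma maxUtility_nonneg (y : EuclideanSpace ℝ ι) : 0 ≤ maxUtility y := le_max_left _ _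

lemma le_maxUtility [Finite ι] (y : EuclideanSpace ℝ ι) (j : ι) : y j ≤ maxUtility y :=
  (le_ciSup (Set.finite_range fun j => y j).bddAbove j).trans (le_max_right _ _)

lemma maxUtility_le {y : EuclideanSpace ℝ ι} {c : ℝ} (hc : 0 ≤ c) (h : ∀ j, y j ≤ c) :
    maxUtility y ≤ c :=
  max_le hc (Real.iSup_le h hc)

lemma maxUtility_eq_zero_or_exists_eq [Finite ι] (y : EuclideanSpace ℝ ι) :
    maxUtility y = 0 ∨ ∃ k, maxUtility y = y k := by
  rcases isEmpty_or_nonempty ι with h | h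
  · exact .inl (le_antisymm (maxUtility_le le_rfl fun j => h.elim j) (maxUtility_nonneg y))
  · obtain ⟨k, hk⟩ := exists_eq_ciSup_of_finite (f := fun j => y j)
    rcases max_choice 0 (⨆ j, y j) with h0 | h0
    · exact .inl h0
    · exact .inr ⟨k, h0.trans hk.symm⟩

variable [Fintype ι]

lemma maxUtility_le_add_norm_sub (y z : EuclideanSpace ℝ ι) :
    maxUtility y ≤ maxUtility z + ‖y - z‖ := by
  refine maxUtility_le (add_nonneg (maxUtility_nonneg z) (norm_nonneg _)) fun j => ?_
  have h1 := le_maxUtility z j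
  have h2 : y j - z j ≤ ‖y - z‖ :=
    (le_abs_self _).trans (PiLp.norm_apply_le (y - z) j)
  linarith

lemma abs_maxUtility_sub_le (y z : EuclideanSpace ℝ ι) :
    |maxUtility y - maxUtility z| ≤ ‖y - z‖ := by
  have h1 := maxUtility_le_add_norm_sub y z
  have h2 := maxUtility_le_add_norm_sub z y
  rw [norm_sub_rev] at h2
  exact abs_le.2 ⟨by linarith, by linarith⟩

lemma continuous_maxUtility : Continuous (maxUtility : EuclideanSpace ℝ ι → ℝ) :=
  (LipschitzWith.of_dist_le' (K := 1) fun y z => by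
    simpa [Real.dist_eq, dist_eq_norm] using abs_maxUtility_sub_le y z).continuous

lemma measurableSet_optimalRegion (j : ι) : MeasurableSet (optimalRegion j) :=
  (isClosed_le continuous_maxUtility (by fun_prop)).measurableSet

/-- Away from ties, `maxUtility` is differentiable. -/
lemma hasFDerivAt_maxUtility {y : EuclideanSpace ℝ ι} (hne : ∀ j q, j ≠ q → y j ≠ y q)
    (hzero : ∀ j, y j ≠ 0) : HasFDerivAt maxUtility (maxUtilityDeriv y) y := by
  classical
  by_cases h0 : maxUtility y = 0
  · have hneg : ∀ j, y j < 0 := fun j => lt_of_le_of_ne (h0 ▸ le_maxUtility y j) (hzero j)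
    have hderiv : maxUtilityDeriv y = 0 := by
      refine Finset.sum_eq_zero fun j _ => ?_
      rw [Set.indicator_of_notMem, zero_smul]
      simpa [optimalRegion, h0] using hneg j
    have hev : ∀ᶠ z : EuclideanSpace ℝ ι in 𝓝 y, ∀ j, z j < 0 :=
      eventually_all.2 fun j =>
        (show Continuous fun z : EuclideanSpace ℝ ι => z j by fun_prop).continuousAt.eventually_lt
          continuousAt_const (hneg j)
    rw [hderiv]
    refine (hasFDerivAt_const (0 : ℝ) y).congr_of_eventuallyEq ?_
    filter_upwards [hev] with z hz
    exact le_antisymm (maxUtility_le le_rfl fun j => (hz j).le) (maxUtility_nonneg z)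
  · obtain ⟨k, hk⟩ := (maxUtility_eq_zero_or_exists_eq y).resolve_left h0
    have hpos : 0 < y k := hk ▸ lt_of_le_of_ne (maxUtility_nonneg y) (Ne.symm h0)
    have hlt : ∀ j, j ≠ k → y j < y k := fun j hj =>
      lt_of_le_of_ne (hk ▸ le_maxUtility y j) (hne j k hj)
    have hderiv : maxUtilityDeriv y = EuclideanSpace.proj k := by
      rw [maxUtilityDeriv, Finset.sum_eq_single k]
      · rw [Set.indicator_of_mem (show y ∈ optimalRegion k from hk.le), one_smul]
      · intro j _ hj
        rw [Set.indicator_of_notMem, zero_smul]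
        simpa [optimalRegion, hk] using hlt j hj
      · simp
    have hev : ∀ᶠ z : EuclideanSpace ℝ ι in 𝓝 y, ∀ j, j ≠ k → z j < z k :=
      eventually_all.2 fun j => eventually_imp_distrib_left.2 fun hj =>
        (show Continuous fun z : EuclideanSpace ℝ ι => z j by fun_prop).continuousAt.eventually_lt
          (show Continuous fun z : EuclideanSpace ℝ ι => z k by fun_prop).continuousAt (hlt j hj)
    have hevpos : ∀ᶠ z : EuclideanSpace ℝ ι in 𝓝 y, 0 < z k :=
      continuousAt_const.eventually_lt
        (show Continuous fun z : EuclideanSpace ℝ ι => z k by fun_prop).continuousAt hpos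
    rw [hderiv]
    have hproj := (EuclideanSpace.proj k : EuclideanSpace ℝ ι →L[ℝ] ℝ).hasFDerivAt (x := y)
    refine hproj.congr_of_eventuallyEq ?_
    filter_upwards [hev, hevpos] with z hz hzpos
    refine le_antisymm (maxUtility_le hzpos.le fun j => ?_) (le_maxUtility z k)
    rcases eq_or_ne j k with rfl | hj
    · exact le_rfl
    · exact (hz j hj).le

end

/-- Equation (2.4): if `F` is tie-null at `x`, then the average consumer
welfare `U` is (Fréchet) differentiable at `x` with gradient equal to the market-share
vector `σ(x)`, i.e. `∂U(x)/∂x_j = σ_j(x)` for every `j`. -/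
theorem gradient_welfare_eq_share (J : ℕ)
    (F : Measure (EuclideanSpace ℝ (Fin J))) [IsProbabilityMeasure F]
    (U : EuclideanSpace ℝ (Fin J) → ℝ)
    (hU : ∀ z, U z = ∫ ε, max 0 (⨆ j : Fin J, (z j + ε j)) ∂F)
    (hInt : ∀ z : EuclideanSpace ℝ (Fin J),
      Integrable (fun ε : EuclideanSpace ℝ (Fin J) => max 0 (⨆ j : Fin J, (z j + ε j))) F)
    (x : EuclideanSpace ℝ (Fin J))
    (σx : EuclideanSpace ℝ (Fin J))
    (hσ : ∀ j : Fin J, σx j =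
      (F {ε : EuclideanSpace ℝ (Fin J) |
        x j + ε j ≥ max 0 (⨆ q : Fin J, (x q + ε q))}).toReal)
    (htie1 : ∀ j q : Fin J, j ≠ q →
      F {ε : EuclideanSpace ℝ (Fin J) | x j + ε j = x q + ε q} = 0)
    (htie2 : ∀ j : Fin J, F {ε : EuclideanSpace ℝ (Fin J) | x j + ε j = 0} = 0) :
    HasGradientAt U σx x := by
  have hUeq : U = fun z => ∫ ε, maxUtility (z + ε) ∂F := funext hU
  have hpre : ∀ j : Fin J, MeasurableSet ((fun ε => x + ε) ⁻¹' optimalRegion j) := fun j =>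
    measurable_const_add x (measurableSet_optimalRegion j)
  have hindicator : ∀ j : Fin J,
      Integrable (fun ε => (optimalRegion j).indicator (fun _ => (1 : ℝ)) (x + ε)) F := fun j =>
    (integrable_const (1 : ℝ)).indicator (hpre j)
  have hmean : ∀ j : Fin J,
      ∫ ε, (optimalRegion j).indicator (fun _ => (1 : ℝ)) (x + ε) ∂F = σx j := fun j =>
    (integral_indicator_one (hpre j)).trans (hσ j).symm
  have hderivInt : Integrable (fun ε : EuclideanSpace ℝ (Fin J) => maxUtilityDeriv (x + ε)) F := by
    simp only [maxUtilityDeriv]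
    exact integrable_sum_smul_const hindicator _
  have hne : ∀ᵐ ε ∂F, ∀ j q : Fin J, j ≠ q → (x + ε) j ≠ (x + ε) q := by
    refine ae_all_iff.2 fun j => ae_all_iff.2 fun q => ae_all_iff.2 fun hjq => ?_
    simpa [ae_iff] using htie1 j q hjq
  have hzero : ∀ᵐ ε ∂F, ∀ j : Fin J, (x + ε) j ≠ 0 := by
    refine ae_all_iff.2 fun j => ?_
    simpa [ae_iff] using htie2 j
  have hderiv : HasFDerivAt U (∫ ε, maxUtilityDeriv (x + ε) ∂F) x := by
    rw [hUeq]
    refine (hasFDerivAt_integral_of_dominated_loc_of_lip'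
      (F := fun z ε => maxUtility (z + ε)) (bound := fun _ => 1) univ_mem
      (fun z _ => (hInt z).aestronglyMeasurable) (hInt x) hderivInt.aestronglyMeasurable
      (ae_of_all _ fun ε z _ => ?_) (integrable_const _) ?_).2
    · simpa using abs_maxUtility_sub_le (z + ε) (x + ε)
    · filter_upwards [hne, hzero] with ε h1 h2
      exact (hasFDerivAt_comp_add_right ε).2 (hasFDerivAt_maxUtility h1 h2)
  have hgrad : ∫ ε, maxUtilityDeriv (x + ε) ∂F = InnerProductSpace.toDual ℝ _ σx := by
    simp only [maxUtilityDeriv]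
    rw [integral_sum_smul_const hindicator]
    simp only [hmean]
    ext v
    simp [PiLp.inner_apply, mul_comm]
  rw [hasGradientAt_iff_hasFDerivAt, ← hgrad]
  exact hderiv
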